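/- Let S_0 = {I} ∪ {Ã_x : x} be a finite set of d×d real symmetric orthogonal matrices containing the identity. Define W_0 := span_ℝ(S_0) and W_{j+1} := span_ℝ{a ∘ b : a, b ∈ W_j}, where a ∘ b := (ab + ba)/2 is the Jordan product; equivalently, W_j is the span of all Jordan products of elements of S_0 of length at most 2^j. Also define V_0 := span_ℝ(S_0) and V_j := span_ℝ(sgn(V_{j−1})) for j ≥ 1. Then W_j ⊆ V_j for every j ≥ 0. -/

import Mathlib

open scoped BigOperators Matrix

noncomputable section

namespace SelfTest

/-- The sign map on real symmetric matrices via the spectral decomposition: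
`sgn(∑ λⱼ uⱼuⱼᵀ) = ∑ sgn(λⱼ) uⱼuⱼᵀ` (and junk value `0` off the symmetric matrices). -/
def msgn {d : ℕ} (H : Matrix (Fin d) (Fin d) ℝ) : Matrix (Fin d) (Fin d) ℝ :=
  if h : H.IsHermitian then
    (h.eigenvectorUnitary : Matrix (Fin d) (Fin d) ℝ) *
      Matrix.diagonal (fun i => Real.sign (h.eigenvalues i)) *
      (star (h.eigenvectorUnitary : Matrix (Fin d) (Fin d) ℝ))
  else 0

end SelfTest

namespace SelfTest

/-- The iterated subspaces `V_0 = span S`, `V_{j+1} = span (sgn(V_j))`. -/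
def Vseq {d : ℕ} (S : Set (Matrix (Fin d) (Fin d) ℝ)) :
    ℕ → Submodule ℝ (Matrix (Fin d) (Fin d) ℝ)
  | 0 => Submodule.span ℝ S
  | j + 1 => Submodule.span ℝ (msgn '' (Vseq S j : Set (Matrix (Fin d) (Fin d) ℝ)))

/-- The real Jordan algebra generated by a set `S` of symmetric matrices: the smallest
linear subspace containing `S ∪ {I}` and closed under the Jordan product
`a ∘ b = (ab + ba)/2`. -/
def JAgen {d : ℕ} (S : Set (Matrix (Fin d) (Fin d) ℝ)) :
    Submodule ℝ (Matrix (Fin d) (Fin d) ℝ) :=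
  sInf {W | S ⊆ (W : Set (Matrix (Fin d) (Fin d) ℝ)) ∧
    (1 : Matrix (Fin d) (Fin d) ℝ) ∈ W ∧
    ∀ a ∈ W, ∀ b ∈ W, (1 / 2 : ℝ) • (a * b + b * a) ∈ W}

/-- The iterated Jordan-product spans: `W_0 = span S`,
`W_{j+1} = span {a ∘ b : a, b ∈ W_j}`. -/
def Wseq {d : ℕ} (S : Set (Matrix (Fin d) (Fin d) ℝ)) :
    ℕ → Submodule ℝ (Matrix (Fin d) (Fin d) ℝ)
  | 0 => Submodule.span ℝ S
  | j + 1 => Submodule.span ℝ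
      {m | ∃ a ∈ Wseq S j, ∃ b ∈ Wseq S j, m = (1 / 2 : ℝ) • (a * b + b * a)}

end SelfTest

open SelfTest

/-- On a finite set of reals, every function is a linear combination of shifted signs. -/
theorem exists_mem_span_sign_eqOn (f : ℝ → ℝ) (s : Finset ℝ) :
    ∃ g ∈ Submodule.span ℝ (Set.range fun t x : ℝ => Real.sign (x - t)), Set.EqOn f g s := by
  induction s using Finset.induction_on_max with
  | empty => exact ⟨0, Submodule.zero_mem _, by simp⟩
  | insert a s hs ih =>
    obtain ⟨g, hg, hfg⟩ := ih
    obtain ⟨t, hta, hst⟩ : ∃ t < a, ∀ x ∈ s, x < t := by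
      have h : ∀ᶠ t in nhdsWithin a (Set.Iio a), ∀ x ∈ s, x < t :=
        (Filter.eventually_all_finset s).2 fun x hx =>
          (eventually_gt_nhds (hs x hx)).filter_mono nhdsWithin_le_nhds
      exact (eventually_mem_nhdsWithin.and h).exists
    refine ⟨g + (f a - g a) • ((fun x => Real.sign (x - t)) - fun x => Real.sign (x - a)),
      Submodule.add_mem _ hg (Submodule.smul_mem _ _ (Submodule.sub_mem _
        (Submodule.subset_span ⟨t, rfl⟩) (Submodule.subset_span ⟨a, rfl⟩))), fun x hx => ?_⟩
    rcases Finset.mem_insert.1 (Finset.mem_coe.1 hx) with rfl | hx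
    · simp [Real.sign_of_pos (sub_pos.2 hta)]
    · simp [Real.sign_of_neg (sub_neg.2 (hst x hx)), Real.sign_of_neg (sub_neg.2 (hs x hx)),
        hfg hx]

namespace SelfTest

variable {d : ℕ} {H : Matrix (Fin d) (Fin d) ℝ}

theorem continuousOn_spectrum (f : ℝ → ℝ) : ContinuousOn f (spectrum ℝ H) :=
  (Matrix.finite_real_spectrum (A := H)).continuousOn f

theorem msgn_eq_cfc (hH : H.IsHermitian) : msgn H = cfc Real.sign H := by
  rw [hH.cfc_eq, Matrix.IsHermitian.cfc, Unitary.conjStarAlgAut_apply, msgn, dif_pos hH]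
  rfl

theorem isHermitian_msgn (H : Matrix (Fin d) (Fin d) ℝ) : (msgn H).IsHermitian := by
  by_cases hH : H.IsHermitian
  · rw [msgn_eq_cfc hH]
    exact cfc_predicate (p := IsSelfAdjoint) Real.sign H
  · rw [msgn, dif_neg hH]
    exact Matrix.isHermitian_zero

theorem msgn_one : msgn (1 : Matrix (Fin d) (Fin d) ℝ) = 1 := by
  rw [msgn_eq_cfc Matrix.isHermitian_one, cfc_apply_one]
  simp

theorem msgn_sub_smul_one (hH : H.IsHermitian) (t : ℝ) :
    msgn (H - t • 1) = cfc (fun x => Real.sign (x - t)) H := by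
  have hsa : IsSelfAdjoint H := hH
  have hsub : cfc (fun x : ℝ => x - t) H = H - t • 1 := by
    rw [cfc_sub (fun x : ℝ => x) (fun _ => t) H, cfc_id' ℝ H, cfc_const t H,
      Algebra.algebraMap_eq_smul_one]
  have hher : (H - t • 1).IsHermitian :=
    hsub ▸ cfc_predicate (p := IsSelfAdjoint) (fun x : ℝ => x - t) H
  rw [msgn_eq_cfc hher, ← hsub]
  exact (cfc_comp' Real.sign (fun x => x - t) H
    ((Matrix.finite_real_spectrum.image _).continuousOn _) (continuousOn_spectrum _) hsa).symm

/-- The span of the signs of a space containing `1` contains every function of each of its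
symmetric elements. -/
theorem cfc_mem_span_msgn {V : Submodule ℝ (Matrix (Fin d) (Fin d) ℝ)} (h1 : 1 ∈ V)
    (hHV : H ∈ V) (hH : H.IsHermitian) (f : ℝ → ℝ) :
    cfc f H ∈ Submodule.span ℝ (msgn '' (V : Set (Matrix (Fin d) (Fin d) ℝ))) := by
  obtain ⟨g, hg, hfg⟩ := exists_mem_span_sign_eqOn f
    (Matrix.finite_real_spectrum (A := H)).toFinset
  rw [Set.Finite.coe_toFinset] at hfg
  rw [cfc_congr hfg]
  clear hfg
  induction hg using Submodule.span_induction with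
  | mem g hg =>
    obtain ⟨t, rfl⟩ := hg
    rw [← msgn_sub_smul_one hH t]
    exact Submodule.subset_span ⟨_, V.sub_mem hHV (V.smul_mem t h1), rfl⟩
  | zero => simp
  | add g₁ g₂ _ _ h₁ h₂ =>
    exact cfc_add H g₁ g₂ (continuousOn_spectrum _) (continuousOn_spectrum _) ▸
      Submodule.add_mem _ h₁ h₂
  | smul c g _ h =>
    exact cfc_smul c g H (continuousOn_spectrum _) ▸ Submodule.smul_mem _ c h

theorem mul_self_mem_span_msgn {V : Submodule ℝ (Matrix (Fin d) (Fin d) ℝ)} (h1 : 1 ∈ V)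
    (hHV : H ∈ V) (hH : H.IsHermitian) :
    H * H ∈ Submodule.span ℝ (msgn '' (V : Set (Matrix (Fin d) (Fin d) ℝ))) := by
  have hsa : IsSelfAdjoint H := hH
  rw [← sq, ← cfc_pow_id (R := ℝ) H 2]
  exact cfc_mem_span_msgn h1 hHV hH _

theorem jordan_mem_span_msgn {V : Submodule ℝ (Matrix (Fin d) (Fin d) ℝ)} (h1 : 1 ∈ V)
    (hV : ∀ M ∈ V, M.IsHermitian) {a b : Matrix (Fin d) (Fin d) ℝ} (ha : a ∈ V) (hb : b ∈ V) :
    (1 / 2 : ℝ) • (a * b + b * a) ∈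
      Submodule.span ℝ (msgn '' (V : Set (Matrix (Fin d) (Fin d) ℝ))) := by
  have hsq : ∀ M ∈ V, M * M ∈ Submodule.span ℝ (msgn '' (V : Set (Matrix (Fin d) (Fin d) ℝ))) :=
    fun M hM => mul_self_mem_span_msgn h1 hM (hV M hM)
  have hpol : a * b + b * a = (a + b) * (a + b) - a * a - b * b := by noncomm_ring
  rw [hpol]
  exact Submodule.smul_mem _ _ (Submodule.sub_mem _ (Submodule.sub_mem _
    (hsq _ (V.add_mem ha hb)) (hsq a ha)) (hsq b hb))

theorem isHermitian_of_mem_span {S : Set (Matrix (Fin d) (Fin d) ℝ)}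
    (hS : ∀ M ∈ S, M.IsHermitian) : ∀ M ∈ Submodule.span ℝ S, M.IsHermitian :=
  fun _ hM => Submodule.span_le (p := selfAdjoint.submodule ℝ (Matrix (Fin d) (Fin d) ℝ)).2 hS hM

variable {S : Set (Matrix (Fin d) (Fin d) ℝ)}

theorem isHermitian_of_mem_Vseq (hS : ∀ M ∈ S, M.IsHermitian) :
    ∀ j, ∀ M ∈ Vseq S j, M.IsHermitian
  | 0 => isHermitian_of_mem_span hS
  | _ + 1 => isHermitian_of_mem_span (Set.forall_mem_image.2 fun H _ => isHermitian_msgn H)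

theorem one_mem_Vseq (hS : 1 ∈ S) : ∀ j, 1 ∈ Vseq S j
  | 0 => Submodule.subset_span hS
  | j + 1 => Submodule.subset_span ⟨1, one_mem_Vseq hS j, msgn_one⟩

theorem Wseq_le_Vseq (h1 : 1 ∈ S) (hS : ∀ M ∈ S, M.IsHermitian) :
    ∀ j, Wseq S j ≤ Vseq S j
  | 0 => le_rfl
  | j + 1 => Submodule.span_le.2 fun _ ⟨_, ha, _, hb, hm⟩ => hm ▸
      jordan_mem_span_msgn (one_mem_Vseq h1 j) (isHermitian_of_mem_Vseq hS j)
        (Wseq_le_Vseq h1 hS j ha) (Wseq_le_Vseq h1 hS j hb)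

end SelfTest

/-- the iterated Jordan-product spans are dominated by the
iterated sgn-spans (Lemma `jordaniter`). -/
theorem stmt_17 {d : ℕ} (A : Finset (Matrix (Fin d) (Fin d) ℝ))
    (hA : ∀ M ∈ A, M.IsSymm ∧ M * M = 1) :
    ∀ j : ℕ,
      Wseq ({1} ∪ (A : Set (Matrix (Fin d) (Fin d) ℝ))) j ≤
        Vseq ({1} ∪ (A : Set (Matrix (Fin d) (Fin d) ℝ))) j := by
  refine Wseq_le_Vseq (Or.inl rfl) ?_
  rintro M (rfl | hM)
  · exact Matrix.isHermitian_one
  · exact (Matrix.conjTranspose_eq_transpose_of_trivial M).trans (hA M hM).1
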